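/- For a, b ∈ ℝ, a positive integer k, and z in the upper half-plane ℍ, define θ'(a,b;z)_k = 2kπi·∑_{n∈ℤ} (a+n)·exp(kπi[(a+n)²z + 2b(a+n)]). Then for all z ∈ ℍ: θ'(a,b;−1/z)_k = k^{−1/2}·i·(−iz)^{3/2}·e^{2kπiab}·∑_{s=0}^{k−1} θ'(b + s/k, −a; z)_k. -/

import Mathlib

/-- The derived theta-constant
`θ'(a,b;z)_k = 2kπi ∑_{n∈ℤ} (a+n) exp(kπi[(a+n)²z + 2b(a+n)])`. -/
noncomputable def thetaConstDeriv (a b : ℝ) (k : ℕ) (z : ℂ) : ℂ :=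
  2 * (k : ℂ) * (Real.pi : ℂ) * Complex.I *
    ∑' n : ℤ, ((a : ℂ) + (n : ℂ)) *
      Complex.exp ((k : ℂ) * (Real.pi : ℂ) * Complex.I *
        (((a : ℂ) + (n : ℂ)) ^ 2 * z + 2 * (b : ℂ) * ((a : ℂ) + (n : ℂ))))

open Complex in
/-- The derived theta series in terms of Mathlib's two-variable Jacobi theta function. -/
lemma hasSum_thetaConstDeriv_term (a b κ τ : ℂ) (hτ : 0 < (κ * τ).im) :
    HasSum (fun n : ℤ ↦ 2 * Real.pi * I * ((a + n) *
        exp (κ * Real.pi * I * ((a + n) ^ 2 * τ + 2 * b * (a + n)))))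
      (exp (κ * Real.pi * I * (a ^ 2 * τ + 2 * a * b)) *
        (2 * Real.pi * I * a * jacobiTheta₂ (κ * (a * τ + b)) (κ * τ) +
          jacobiTheta₂' (κ * (a * τ + b)) (κ * τ))) := by
  convert! (((hasSum_jacobiTheta₂_term (κ * (a * τ + b)) hτ).mul_left
    (2 * Real.pi * I * a)).add (hasSum_jacobiTheta₂'_term (κ * (a * τ + b)) hτ)).mul_left
    (exp (κ * Real.pi * I * (a ^ 2 * τ + 2 * a * b))) using 2 with n
  have h : exp (κ * Real.pi * I * ((a + n) ^ 2 * τ + 2 * b * (a + n))) =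
      exp (κ * Real.pi * I * (a ^ 2 * τ + 2 * a * b)) *
        jacobiTheta₂_term n (κ * (a * τ + b)) (κ * τ) := by
    rw [jacobiTheta₂_term, ← exp_add]
    ring_nf
  rw [h, jacobiTheta₂'_term]
  ring

lemma Summable.tsum_int_eq_sum_tsum_mul_add {f : ℤ → ℂ} (hf : Summable f) {k : ℕ} (hk : 0 < k) :
    ∑' m : ℤ, f m = ∑ s ∈ Finset.range k, ∑' n : ℤ, f (n * k + s) := by
  have : NeZero k := ⟨hk.ne'⟩
  let e := (Equiv.prodComm (Fin k) ℤ).trans (Int.divModEquiv k).symm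
  have he : Summable fun p : Fin k × ℤ ↦ f (e p) := e.summable_iff.mpr hf
  rw [← e.tsum_eq, he.tsum_prod, tsum_fintype,
    Finset.sum_range fun s ↦ ∑' n : ℤ, f (n * k + s)]
  simp [e, Int.divModEquiv]

open Complex in
lemma thetaConstDeriv_eq_jacobiTheta₂ (a b : ℝ) {k : ℕ} (hk : 0 < k) {τ : ℂ} (hτ : 0 < τ.im) :
    thetaConstDeriv a b k τ = k * (exp (k * Real.pi * I * (a ^ 2 * τ + 2 * a * b)) *
      (2 * Real.pi * I * a * jacobiTheta₂ (k * (a * τ + b)) (k * τ) +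
        jacobiTheta₂' (k * (a * τ + b)) (k * τ))) := by
  have h : 0 < ((k : ℂ) * τ).im := by
    rw [← ofReal_natCast, im_ofReal_mul]
    positivity
  rw [← (hasSum_thetaConstDeriv_term a b k τ h).tsum_eq, tsum_mul_left, thetaConstDeriv]
  ring

open Complex in
lemma sum_thetaConstDeriv_eq_jacobiTheta₂ (a b : ℝ) {k : ℕ} (hk : 0 < k) {z : ℂ}
    (hz : 0 < z.im) :
    ∑ s ∈ Finset.range k, thetaConstDeriv (b + (s : ℝ) / (k : ℝ)) (-a) k z =
      exp (k * Real.pi * I * (b ^ 2 * z - 2 * a * b)) *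
        (2 * Real.pi * I * (k * b) * jacobiTheta₂ (b * z - a) (z / k) +
          jacobiTheta₂' (b * z - a) (z / k)) := by
  have hk0 : (k : ℂ) ≠ 0 := by exact_mod_cast hk.ne'
  have h : 0 < ((k : ℂ)⁻¹ * z).im := by
    rw [← ofReal_natCast, ← ofReal_inv, im_ofReal_mul]
    positivity
  have H := hasSum_thetaConstDeriv_term (k * b) (-(k * a)) (k : ℂ)⁻¹ z h
  have e₁ : (k : ℂ)⁻¹ * (k * b * z + -(k * a)) = b * z - a := by
    field_simp
    ring
  have e₂ : (k : ℂ)⁻¹ * Real.pi * I * ((k * b) ^ 2 * z + 2 * (k * b) * -(k * a)) =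
      k * Real.pi * I * (b ^ 2 * z - 2 * a * b) := by
    field_simp
    ring
  rw [e₁, e₂, inv_mul_eq_div _ z] at H
  rw [← H.tsum_eq, H.summable.tsum_int_eq_sum_tsum_mul_add hk]
  refine Finset.sum_congr rfl fun s _ ↦ ?_
  rw [thetaConstDeriv, ← tsum_mul_left]
  refine tsum_congr fun n ↦ ?_
  have e₃ : (k : ℂ)⁻¹ * Real.pi * I * ((k * b + (n * k + s : ℤ)) ^ 2 * z +
        2 * -(k * a) * (k * b + (n * k + s : ℤ))) =
      k * Real.pi * I * (((b + (s : ℝ) / (k : ℝ) : ℝ) + n) ^ 2 * z +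
        2 * (-a : ℝ) * ((b + (s : ℝ) / (k : ℝ) : ℝ) + n)) := by
    push_cast
    field_simp
    ring
  rw [e₃]
  push_cast
  field_simp
  ring

open Complex in
lemma ofReal_mul_cpow {r : ℝ} (hr : 0 < r) {w : ℂ} (hw : w ≠ 0) (s : ℂ) :
    ((r : ℂ) * w) ^ s = (r : ℂ) ^ s * w ^ s := by
  have hr0 : (r : ℂ) ≠ 0 := ofReal_ne_zero.mpr hr.ne'
  rw [cpow_def_of_ne_zero (mul_ne_zero hr0 hw), cpow_def_of_ne_zero hr0,
    cpow_def_of_ne_zero hw, log_ofReal_mul hr hw, ofReal_log hr.le, add_mul, exp_add]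

open Complex in
lemma one_div_cpow_mul_eq {k : ℕ} (hk : 0 < k) {z : ℂ} (hz : 0 < z.im) :
    1 / (-I * (k * (-1 / z))) ^ (1 / 2 : ℂ) * z =
      (k : ℂ) ^ (-(1 / 2 : ℂ)) * I * (-I * z) ^ (3 / 2 : ℂ) := by
  have hz0 : z ≠ 0 := by
    rintro rfl
    simp at hz
  have hw0 : -I * z ≠ 0 := mul_ne_zero (neg_ne_zero.mpr I_ne_zero) hz0
  have harg : (-I * z).arg ≠ Real.pi := fun h ↦ by
    have := (arg_eq_pi_iff.mp h).1
    simp at this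
    linarith
  have e : -I * (k * (-1 / z)) = (k : ℝ) * (-I * z)⁻¹ := by
    rw [mul_inv, inv_neg, inv_I, ofReal_natCast]
    field_simp
  have hpow : (-I * z) ^ (3 / 2 : ℂ) = (-I * z) * (-I * z) ^ (1 / 2 : ℂ) := by
    rw [show (3 / 2 : ℂ) = 1 + 1 / 2 by norm_num, cpow_add _ _ hw0, cpow_one]
  rw [e, ofReal_mul_cpow (Nat.cast_pos.mpr hk) (inv_ne_zero hw0), inv_cpow _ _ harg, hpow,
    cpow_neg, ofReal_natCast, one_div, mul_inv, inv_inv]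
  linear_combination (-((k : ℂ) ^ (1 / 2 : ℂ))⁻¹ * (-I * z) ^ (1 / 2 : ℂ) * z) * -I_sq

/-- the transformation formula
`θ'(a,b;−1/z)_k = k^{−1/2} i (−iz)^{3/2} e^{2kπiab} ∑_{s=0}^{k−1} θ'(b+s/k,−a;z)_k`. -/
theorem thetaConstDeriv_inversion (a b : ℝ) (k : ℕ) (hk : 0 < k)
    (z : ℂ) (hz : 0 < z.im) :
    thetaConstDeriv a b k (-1 / z) =
      (k : ℂ) ^ (-(1 / 2 : ℂ)) * Complex.I * (-Complex.I * z) ^ (3 / 2 : ℂ) *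
        Complex.exp (2 * (k : ℂ) * (Real.pi : ℂ) * Complex.I * (a : ℂ) * (b : ℂ)) *
        ∑ s ∈ Finset.range k, thetaConstDeriv (b + (s : ℝ) / (k : ℝ)) (-a) k z := by
  have hk0 : (k : ℂ) ≠ 0 := by exact_mod_cast hk.ne'
  have hz0 : z ≠ 0 := by
    rintro rfl
    simp at hz
  have hz' : 0 < (-1 / z).im := by
    rw [neg_div, Complex.neg_im, one_div, Complex.inv_im, neg_div, neg_neg]
    exact div_pos hz (Complex.normSq_pos.mpr hz0)
  rw [← one_div_cpow_mul_eq hk hz, sum_thetaConstDeriv_eq_jacobiTheta₂ a b hk hz,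
    thetaConstDeriv_eq_jacobiTheta₂ a b hk hz', jacobiTheta₂_functional_equation,
    jacobiTheta₂'_functional_equation]
  have e₁ : k * (a * (-1 / z) + b) / (k * (-1 / z)) = -(b * z - a) := by
    field_simp
    ring
  have e₂ : -1 / (k * (-1 / z)) = z / k := by
    field_simp
  have e₃ : Complex.exp (2 * k * Real.pi * Complex.I * a * b) *
        Complex.exp (k * Real.pi * Complex.I * (b ^ 2 * z - 2 * a * b)) =
      Complex.exp (k * Real.pi * Complex.I * (a ^ 2 * (-1 / z) + 2 * a * b)) *
        Complex.exp (-Real.pi * Complex.I * (k * (a * (-1 / z) + b)) ^ 2 / (k * (-1 / z))) := by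
    rw [← Complex.exp_add, ← Complex.exp_add]
    congr 1
    field_simp
    ring
  rw [e₁, e₂, jacobiTheta₂_neg_left, jacobiTheta₂'_neg_left]
  generalize 1 / (-Complex.I * (k * (-1 / z))) ^ (1 / 2 : ℂ) = c
  generalize jacobiTheta₂ _ _ = J
  generalize jacobiTheta₂' _ _ = J'
  generalize Complex.exp (k * Real.pi * Complex.I * (a ^ 2 * (-1 / z) + 2 * a * b)) = A at e₃ ⊢
  generalize Complex.exp (-Real.pi * Complex.I * (k * (a * (-1 / z) + b)) ^ 2 /
    (k * (-1 / z))) = B at e₃ ⊢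
  trans c * z * (A * B) * (2 * Real.pi * Complex.I * (k * b) * J + J')
  · field_simp
    ring
  · rw [← e₃]
    ring
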